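/- arXiv:1301.1118 — 2 statements merged into one kernel-verified Lean document; each statement's English description precedes it below -/
import Mathlib

section
/- Let d be a positive integer. In the lattice U(2) ⊕ E8(2) with basis x, y, e1, ..., e8, let M_{3,d} be the submodule spanned by x + d·y, e1, e3 and e6, and let N_{3,d} = {v : B(v, m) = 0 for all m ∈ M_{3,d}} be its orthogonal complement. Then N_{3,d} is a free ℤ-module of rank 6, the bilinear form restricted to N_{3,d} is negative definite, and N_{3,d} contains no vector v with B(v,v) = −2. -/
open Matrix

/-- Gram matrix of the lattice `U(2) ⊕ E8(2)` in the basis `x, y, e1, …, e8`. -/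
def gramU2E82 : Matrix (Fin 10) (Fin 10) ℤ :=
  !![0, 2, 0, 0, 0, 0, 0, 0, 0, 0;
     2, 0, 0, 0, 0, 0, 0, 0, 0, 0;
     0, 0, -4, 2, 0, 0, 0, 0, 0, 0;
     0, 0, 2, -4, 2, 0, 0, 0, 0, 0;
     0, 0, 0, 2, -4, 2, 2, 0, 0, 0;
     0, 0, 0, 0, 2, -4, 0, 0, 0, 0;
     0, 0, 0, 0, 2, 0, -4, 2, 0, 0;
     0, 0, 0, 0, 0, 0, 2, -4, 2, 0;
     0, 0, 0, 0, 0, 0, 0, 2, -4, 2;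
     0, 0, 0, 0, 0, 0, 0, 0, 2, -4]

/-- The bilinear form of `U(2) ⊕ E8(2)`. -/
def bU2E82 (v w : Fin 10 → ℤ) : ℤ := v ⬝ᵥ (gramU2E82 *ᵥ w)

/-- The orthogonal complement of a submodule of `U(2) ⊕ E8(2)`. -/
def orthCompl (M : Submodule ℤ (Fin 10 → ℤ)) : Submodule ℤ (Fin 10 → ℤ) where
  carrier := {v | ∀ m ∈ M, bU2E82 v m = 0}
  add_mem' := by
    intro a b ha hb m hm
    simp only [bU2E82, add_dotProduct] at *
    rw [ha m hm, hb m hm, add_zero]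
  zero_mem' := by
    intro m hm
    simp [bU2E82]
  smul_mem' := by
    intro c v hv m hm
    simp only [bU2E82, smul_eq_mul, smul_dotProduct] at *
    rw [hv m hm, mul_zero]

/-- The sublattice `M_{3,d}` of `U(2) ⊕ E8(2)`, spanned by `x + d·y`, `e1`, `e3` and `e6`. -/
def M3 (d : ℤ) : Submodule ℤ (Fin 10 → ℤ) :=
  Submodule.span ℤ
    {Pi.single 0 1 + d • Pi.single 1 1, Pi.single 2 1, Pi.single 4 1, Pi.single 7 1}

/-- The lattice `N_{3,d}`, the orthogonal complement of `M_{3,d}` in `U(2) ⊕ E8(2)`. -/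
def N3 (d : ℤ) : Submodule ℤ (Fin 10 → ℤ) := orthCompl (M3 d)

/-- The form of `U(2) ⊕ E8(2)` is divisible by `4` on the diagonal. -/
theorem bU2E82_self (v : Fin 10 → ℤ) :
    bU2E82 v v = 4 * (v 0 * v 1 - (v 2 ^ 2 + v 3 ^ 2 + v 4 ^ 2 + v 5 ^ 2 + v 6 ^ 2 + v 7 ^ 2 +
      v 8 ^ 2 + v 9 ^ 2 - v 2 * v 3 - v 3 * v 4 - v 4 * v 5 - v 4 * v 6 - v 6 * v 7 -
      v 7 * v 8 - v 8 * v 9)) := by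
  simp [bU2E82, gramU2E82, dotProduct, mulVec, Fin.sum_univ_succ]
  ring

theorem mem_orthCompl_span {S : Set (Fin 10 → ℤ)} {v : Fin 10 → ℤ} :
    v ∈ orthCompl (Submodule.span ℤ S) ↔ ∀ m ∈ S, bU2E82 v m = 0 := by
  refine ⟨fun h m hm => h m (Submodule.subset_span hm), fun h m hm => ?_⟩
  induction hm using Submodule.span_induction with
  | mem m hm => exact h m hm
  | zero => simp [bU2E82]
  | add a b _ _ ha hb =>
    simp only [bU2E82, mulVec_add, dotProduct_add] at *
    rw [ha, hb, add_zero]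
  | smul c a _ ha =>
    simp only [bU2E82, mulVec_smul, dotProduct_smul] at *
    rw [ha, smul_zero]

theorem mem_N3_iff {d : ℤ} {v : Fin 10 → ℤ} :
    v ∈ N3 d ↔ v 1 = -d * v 0 ∧ v 3 = 2 * v 2 ∧ v 6 = 2 * v 4 - 2 * v 2 - v 5 ∧
      v 8 = 2 * v 7 - 2 * v 4 + 2 * v 2 + v 5 := by
  rw [N3, M3, mem_orthCompl_span]
  simp only [Set.mem_insert_iff, Set.mem_singleton_iff, forall_eq_or_imp, forall_eq]
  simp [bU2E82, gramU2E82, dotProduct, mulVec_add, Fin.sum_univ_succ]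
  constructor
  · rintro ⟨h0, h1, h2, h3⟩
    refine ⟨?_, ?_, ?_, ?_⟩ <;> linarith
  · rintro ⟨h0, h1, h2, h3⟩
    refine ⟨?_, ?_, ?_, ?_⟩ <;> linarith

/-- The six coordinates of `x, e1, e3, e4, e6, e8` parametrize `N_{3,d}`. -/
def N3Equiv (d : ℤ) : N3 d ≃ₗ[ℤ] (Fin 6 → ℤ) where
  toFun v := ![v.1 0, v.1 2, v.1 4, v.1 5, v.1 7, v.1 9]
  map_add' v w := by
    ext i
    fin_cases i <;> rfl
  map_smul' c v := by
    ext i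
    fin_cases i <;> rfl
  invFun c := ⟨![c 0, -d * c 0, c 1, 2 * c 1, c 2, c 3, 2 * c 2 - 2 * c 1 - c 3, c 4,
    2 * c 4 - 2 * c 2 + 2 * c 1 + c 3, c 5], mem_N3_iff.2 ⟨rfl, rfl, rfl, rfl⟩⟩
  left_inv v := by
    obtain ⟨h1, h3, h6, h8⟩ := mem_N3_iff.1 v.2
    ext i
    fin_cases i
    exacts [rfl, h1.symm, rfl, h3.symm, rfl, rfl, h6.symm, rfl, h8.symm, rfl]
  right_inv c := by
    ext i
    fin_cases i <;> rfl

theorem N3_negDef {d : ℤ} (hd : 0 < d) {v : Fin 10 → ℤ} (hv : v ∈ N3 d) (hv0 : v ≠ 0) :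
    bU2E82 v v < 0 := by
  obtain ⟨h1, -⟩ := mem_N3_iff.1 hv
  by_contra! h
  have hsos : 30 * bU2E82 v v = -(120 * (d * v 0 ^ 2) + 30 * (2 * v 2 - v 3) ^ 2 +
      10 * (3 * v 3 - 2 * v 4) ^ 2 + 30 * (2 * v 5 - v 4) ^ 2 + 30 * (2 * v 9 - v 8) ^ 2 +
      10 * (3 * v 8 - 2 * v 7) ^ 2 + 5 * (4 * v 7 - 3 * v 6) ^ 2 +
      3 * (5 * v 6 - 4 * v 4) ^ 2 + 2 * v 4 ^ 2) := by
    rw [bU2E82_self, h1]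
    ring
  have p0 : 0 ≤ d * v 0 ^ 2 := by positivity
  have p1 := sq_nonneg (2 * v 2 - v 3)
  have p2 := sq_nonneg (3 * v 3 - 2 * v 4)
  have p3 := sq_nonneg (2 * v 5 - v 4)
  have p4 := sq_nonneg (2 * v 9 - v 8)
  have p5 := sq_nonneg (3 * v 8 - 2 * v 7)
  have p6 := sq_nonneg (4 * v 7 - 3 * v 6)
  have p7 := sq_nonneg (5 * v 6 - 4 * v 4)
  have p8 := sq_nonneg (v 4)
  have q0 : v 0 = 0 := by
    have : d * v 0 ^ 2 = 0 := by linarith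
    simpa [hd.ne'] using this
  have q1 : 2 * v 2 - v 3 = 0 := pow_eq_zero_iff two_ne_zero |>.1 (by linarith)
  have q2 : 3 * v 3 - 2 * v 4 = 0 := pow_eq_zero_iff two_ne_zero |>.1 (by linarith)
  have q3 : 2 * v 5 - v 4 = 0 := pow_eq_zero_iff two_ne_zero |>.1 (by linarith)
  have q4 : 2 * v 9 - v 8 = 0 := pow_eq_zero_iff two_ne_zero |>.1 (by linarith)
  have q5 : 3 * v 8 - 2 * v 7 = 0 := pow_eq_zero_iff two_ne_zero |>.1 (by linarith)
  have q6 : 4 * v 7 - 3 * v 6 = 0 := pow_eq_zero_iff two_ne_zero |>.1 (by linarith)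
  have q7 : 5 * v 6 - 4 * v 4 = 0 := pow_eq_zero_iff two_ne_zero |>.1 (by linarith)
  have q8 : v 4 = 0 := pow_eq_zero_iff two_ne_zero |>.1 (by linarith)
  have r1 : v 1 = 0 := by simp [h1, q0]
  apply hv0
  ext i
  fin_cases i <;> simp only [Fin.reduceFinMk, Fin.zero_eta, Fin.mk_one, Pi.zero_apply] <;> omega

/-- `N_{3,d}` is free of rank 6, negative definite, and contains no vector of
square `-2`. -/
theorem N3_free_negdef_no_minus_two (d : ℤ) (hd : 0 < d) :
    Module.Free ℤ ↥(N3 d) ∧ Module.finrank ℤ ↥(N3 d) = 6 ∧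
      (∀ v ∈ N3 d, v ≠ 0 → bU2E82 v v < 0) ∧
      (∀ v ∈ N3 d, bU2E82 v v ≠ -2) := by
  refine ⟨Module.Free.of_equiv (N3Equiv d).symm, ?_, fun v hv hv0 => N3_negDef hd hv hv0,
    fun v _ h => ?_⟩
  · rw [(N3Equiv d).finrank_eq, Module.finrank_fin_fun]
  · rw [bU2E82_self] at h
    omega
end

section
/- Let d be a positive integer. In the lattice U(2) ⊕ E8(2) with basis x, y, e1, ..., e8, let N_{3,d} be the orthogonal complement of the submodule spanned by x + d·y, e1, e3 and e6. Then the discriminant group l(N_{3,d}) = N_{3,d}*/N_{3,d} is isomorphic as an abelian group to (ℤ/4dℤ) ⊕ (ℤ/4ℤ)^3 ⊕ (ℤ/2ℤ)^2. -/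
open Matrix

/-- The same bilinear form, extended to `ℚ^10`. -/
def bQ (v w : Fin 10 → ℚ) : ℚ := v ⬝ᵥ ((gramU2E82.map (Int.cast : ℤ → ℚ)) *ᵥ w)

/-- The coordinatewise inclusion `ℤ^10 → ℚ^10`, as a `ℤ`-linear map. -/
def castQ : (Fin 10 → ℤ) →ₗ[ℤ] (Fin 10 → ℚ) where
  toFun v := fun i => (v i : ℚ)
  map_add' a b := by
    funext i
    simp only [Pi.add_apply]
    push_cast
    ring
  map_smul' c v := by
    funext i
    simp only [Pi.smul_apply, RingHom.id_apply, smul_eq_mul, zsmul_eq_mul]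
    push_cast
    ring

/-- The dual lattice `N* = {v ∈ N ⊗ ℚ : B(v, w) ∈ ℤ for all w ∈ N}` of a sublattice `N` of
`U(2) ⊕ E8(2)`, realized inside `ℚ^10` as the set of vectors of the ℚ-span of `N` pairing
integrally with `N`. -/
def dualLattice (N : Submodule ℤ (Fin 10 → ℤ)) : Submodule ℤ (Fin 10 → ℚ) where
  carrier := {v | v ∈ Submodule.span ℚ (castQ '' (N : Set (Fin 10 → ℤ))) ∧
                  ∀ w ∈ N, ∃ n : ℤ, bQ v (castQ w) = n}
  add_mem' := by
    intro a b ha hb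
    refine ⟨Submodule.add_mem _ ha.1 hb.1, fun w hw => ?_⟩
    obtain ⟨m, hm⟩ := ha.2 w hw
    obtain ⟨n, hn⟩ := hb.2 w hw
    refine ⟨m + n, ?_⟩
    simp only [bQ, add_dotProduct] at *
    rw [hm, hn]; push_cast; ring
  zero_mem' := by
    refine ⟨Submodule.zero_mem _, fun w hw => ⟨0, ?_⟩⟩
    simp [bQ]
  smul_mem' := by
    intro c v hv
    refine ⟨by
      rw [← Int.cast_smul_eq_zsmul ℚ]
      exact Submodule.smul_mem _ _ hv.1, fun w hw => ?_⟩
    obtain ⟨n, hn⟩ := hv.2 w hw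
    refine ⟨c * n, ?_⟩
    have : (c • v) = (c : ℚ) • v := (Int.cast_smul_eq_zsmul ℚ c v).symm
    simp only [bQ, this, smul_dotProduct, smul_eq_mul] at *
    rw [hn]; push_cast; ring

/-- The discriminant group `l(N) = N*/N` of a sublattice `N` of `U(2) ⊕ E8(2)`. -/
abbrev discGroup (N : Submodule ℤ (Fin 10 → ℤ)) :=
  ↥(dualLattice N) ⧸ (Submodule.comap (dualLattice N).subtype (N.map castQ))

theorem bQ_eq_toBilin' (v w : Fin 10 → ℚ) :
    bQ v w = Matrix.toBilin' (gramU2E82.map (Int.cast : ℤ → ℚ)) v w :=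
  (Matrix.toBilin'_apply' _ _ _).symm

theorem castQ_apply (v : Fin 10 → ℤ) (i : Fin 10) : castQ v i = v i := rfl

theorem bQ_castQ (v w : Fin 10 → ℤ) : bQ (castQ v) (castQ w) = bU2E82 v w := by
  simp [bQ, bU2E82, dotProduct, Matrix.mulVec, castQ_apply]

theorem bQ_sum_smul_left {ι : Type*} [Fintype ι] (q : ι → ℚ) (v : ι → Fin 10 → ℚ)
    (w : Fin 10 → ℚ) : bQ (∑ i, q i • v i) w = ∑ i, q i * bQ (v i) w := by
  simp [bQ_eq_toBilin', map_sum, LinearMap.sum_apply]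

theorem bQ_sum_smul_right {ι : Type*} [Fintype ι] (v : Fin 10 → ℚ) (q : ι → ℚ)
    (w : ι → Fin 10 → ℚ) : bQ v (∑ i, q i • w i) = ∑ i, q i * bQ v (w i) := by
  simp [bQ_eq_toBilin', map_sum]

theorem castQ_sum_smul {ι : Type*} [Fintype ι] (k : ι → ℤ) (v : ι → Fin 10 → ℤ) :
    castQ (∑ i, k i • v i) = ∑ i, (k i : ℚ) • castQ (v i) := by
  simp only [map_sum, map_smul, Int.cast_smul_eq_zsmul]

/-- If `w` and `u` are spanning families of `N` with `B(w i, u j) = D i` for `i = j` and `0`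
otherwise, then `discGroup N` is isomorphic to any quotient of `ℤ^ι` by `∏ i, D i ℤ`. -/
theorem nonempty_discGroup_addEquiv {ι A : Type*} [Fintype ι] [DecidableEq ι] [AddCommGroup A]
    {N : Submodule ℤ (Fin 10 → ℤ)} (w u : ι → Fin 10 → ℤ) (D : ι → ℤ) (hD : ∀ i, D i ≠ 0)
    (hw : Submodule.span ℤ (Set.range w) = N) (hu : Submodule.span ℤ (Set.range u) = N)
    (hwu : ∀ i j, bU2E82 (w i) (u j) = if i = j then D i else 0)
    (ψ : (ι → ℤ) →+ A) (hψ : Function.Surjective ψ) (hker : ∀ t, ψ t = 0 ↔ ∀ i, D i ∣ t i) :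
    Nonempty (discGroup N ≃+ A) := by
  have hDQ : ∀ i, (D i : ℚ) ≠ 0 := fun i => Int.cast_ne_zero.2 (hD i)
  have hpair : ∀ (q : ι → ℚ) (j : ι), bQ (∑ i, q i • castQ (w i)) (castQ (u j)) = q j * D j := by
    intro q j
    simp [bQ_sum_smul_left, bQ_castQ, hwu]
  have hmem : ∀ t : ι → ℤ, ∑ i, ((t i : ℚ) / D i) • castQ (w i) ∈ dualLattice N := by
    intro t
    refine ⟨Submodule.sum_mem _ fun i _ => Submodule.smul_mem _ _ (Submodule.subset_span
      ⟨w i, hw ▸ Submodule.subset_span ⟨i, rfl⟩, rfl⟩), fun z hz => ?_⟩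
    rw [← hu, Submodule.mem_span_range_iff_exists_fun] at hz
    obtain ⟨k, rfl⟩ := hz
    refine ⟨∑ i, k i * t i, ?_⟩
    rw [castQ_sum_smul, bQ_sum_smul_right]
    simp only [hpair, div_mul_cancel₀ _ (hDQ _)]
    push_cast
    rfl
  let φ : (ι → ℤ) →+ discGroup N :=
    { toFun := fun t => Submodule.Quotient.mk ⟨_, hmem t⟩
      map_zero' := by
        rw [Submodule.Quotient.mk_eq_zero]
        convert Submodule.zero_mem _
        simp
      map_add' := fun s t => by
        rw [← Submodule.Quotient.mk_add]
        congr 1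
        ext1
        simp [add_div, add_smul, Finset.sum_add_distrib] }
  have hφ : Function.Surjective φ := by
    intro z
    obtain ⟨⟨v, hv⟩, rfl⟩ := Submodule.Quotient.mk_surjective _ z
    have hspan : v ∈ Submodule.span ℚ (Set.range fun i => castQ (w i)) := by
      refine Submodule.span_le.2 ?_ hv.1
      rintro _ ⟨z, hz, rfl⟩
      rw [SetLike.mem_coe, ← hw, Submodule.mem_span_range_iff_exists_fun] at hz
      obtain ⟨k, rfl⟩ := hz
      rw [castQ_sum_smul]
      exact Submodule.sum_mem _ fun i _ =>
        Submodule.smul_mem _ _ (Submodule.subset_span ⟨i, rfl⟩)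
    obtain ⟨q, rfl⟩ := (Submodule.mem_span_range_iff_exists_fun ℚ).1 hspan
    choose t ht using fun i => hv.2 (u i) (hu ▸ Submodule.subset_span ⟨i, rfl⟩)
    refine ⟨t, congrArg Submodule.Quotient.mk (Subtype.ext ?_)⟩
    refine Finset.sum_congr rfl fun i _ => ?_
    rw [← ht i, hpair, mul_div_cancel_right₀ _ (hDQ i)]
  have hφker : ∀ t, φ t = 0 ↔ ∀ i, D i ∣ t i := by
    intro t
    refine (Submodule.Quotient.mk_eq_zero _).trans ⟨?_, fun h => ?_⟩
    · rintro ⟨z, hz, hzt⟩ i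
      rw [SetLike.mem_coe, ← hw, Submodule.mem_span_range_iff_exists_fun] at hz
      obtain ⟨k, rfl⟩ := hz
      have h := congrArg (fun v => bQ v (castQ (u i))) hzt
      simp only [castQ_sum_smul, hpair, Submodule.subtype_apply,
        div_mul_cancel₀ _ (hDQ _)] at h
      exact ⟨k i, by rw [mul_comm]; exact_mod_cast h.symm⟩
    · choose k hk using h
      refine ⟨∑ i, k i • w i, ?_, ?_⟩
      · rw [← hw]
        exact Submodule.sum_mem _ fun i _ =>
          Submodule.smul_mem _ _ (Submodule.subset_span ⟨i, rfl⟩)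
      · rw [castQ_sum_smul]
        refine Finset.sum_congr rfl fun i _ => ?_
        rw [hk i, Int.cast_mul, mul_div_cancel_left₀ _ (hDQ i)]
  have hkers : φ.ker = ψ.ker := by
    ext t
    rw [AddMonoidHom.mem_ker, AddMonoidHom.mem_ker, hφker, hker]
  exact ⟨(QuotientAddGroup.quotientKerEquivOfSurjective φ hφ).symm.trans
    ((QuotientAddGroup.quotientAddEquivOfEq hkers).trans
      (QuotientAddGroup.quotientKerEquivOfSurjective ψ hψ))⟩

theorem bU2E82_apply (v w : Fin 10 → ℤ) :
    bU2E82 v w = v 0 * (2 * w 1) + v 1 * (2 * w 0) + v 2 * (-4 * w 2 + 2 * w 3) +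
      v 3 * (2 * w 2 - 4 * w 3 + 2 * w 4) + v 4 * (2 * w 3 - 4 * w 4 + 2 * w 5 + 2 * w 6) +
      v 5 * (2 * w 4 - 4 * w 5) + v 6 * (2 * w 4 - 4 * w 6 + 2 * w 7) +
      v 7 * (2 * w 6 - 4 * w 7 + 2 * w 8) + v 8 * (2 * w 7 - 4 * w 8 + 2 * w 9) +
      v 9 * (2 * w 8 - 4 * w 9) := by
  simp [bU2E82, gramU2E82, dotProduct, Matrix.mulVec, Fin.sum_univ_succ]
  ring

theorem mem_N3 {d : ℤ} {v : Fin 10 → ℤ} :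
    v ∈ N3 d ↔ v 1 = -d * v 0 ∧ v 3 = 2 * v 2 ∧ v 3 + v 5 + v 6 = 2 * v 4 ∧
      v 6 + v 8 = 2 * v 7 := by
  have hspan : v ∈ N3 d ↔ ∀ m ∈ ({Pi.single 0 1 + d • Pi.single 1 1, Pi.single 2 1,
      Pi.single 4 1, Pi.single 7 1} : Set (Fin 10 → ℤ)), bU2E82 v m = 0 := by
    refine ⟨fun h m hm => h m (Submodule.subset_span hm), fun h m hm => ?_⟩
    induction hm using Submodule.span_induction with
    | mem m hm => exact h m hm
    | zero => simp [bU2E82]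
    | add a b _ _ ha hb =>
      simp only [bU2E82, Matrix.mulVec_add, dotProduct_add] at *
      rw [ha, hb, add_zero]
    | smul c a _ ha =>
      simp only [bU2E82, Matrix.mulVec_smul, dotProduct_smul] at *
      rw [ha, smul_zero]
  rw [hspan]
  simp [bU2E82_apply]
  grind

/-- A basis of `N3 d`. -/
def basisN3 (d : ℤ) : Fin 6 → Fin 10 → ℤ :=
  ![![1, -d, 0, 0, 0, 0, 0, 0, 0, 0],
    ![0, 0, 0, 0, -44, -74, -14, 1, 16, 8],
    ![0, 0, -1, -2, -24, -38, -8, 0, 8, 4],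
    ![0, 0, -2, -4, -11, -12, -6, -3, 0, 0],
    ![0, 0, 0, 0, 0, 1, -1, 0, 1, 0],
    ![0, 0, 0, 0, -6, -10, -2, 0, 2, 1]]

/-- A basis of `N3 d` biorthogonal to `basisN3 d`. -/
def cobasisN3 (d : ℤ) : Fin 6 → Fin 10 → ℤ :=
  ![![-1, d, 0, 0, 0, 0, 0, 0, 0, 0],
    ![0, 0, 0, 0, 3, 0, 6, 1, -4, -20],
    ![0, 0, -1, -2, -6, -2, -8, -4, 0, 12],
    ![0, 0, 4, 8, 13, 6, 12, 8, 4, -4],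
    ![0, 0, 0, 0, 0, 0, 0, 0, 0, 1],
    ![0, 0, 0, 0, -6, 1, -13, 0, 13, 54]]

theorem span_basisN3 (d : ℤ) : Submodule.span ℤ (Set.range (basisN3 d)) = N3 d := by
  refine le_antisymm (Submodule.span_le.2 ?_) fun v hv => ?_
  · rintro _ ⟨i, rfl⟩
    rw [SetLike.mem_coe, mem_N3]
    fin_cases i <;> simp [basisN3]
  · obtain ⟨h1, h2, h3, h4⟩ := mem_N3.1 hv
    refine (Submodule.mem_span_range_iff_exists_fun ℤ).2 ⟨![v 0,
      3 * v 4 - 11 * v 7 + 18 * v 9,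
      -v 2 - 2 * v 4 + 8 * v 7 - 12 * v 9,
      v 4 - 4 * v 7 + 6 * v 9,
      2 * v 2 - 2 * v 4 + v 5 + 2 * v 7 - 2 * v 9,
      4 * v 2 - 16 * v 4 + 56 * v 7 - 95 * v 9], ?_⟩
    funext i
    fin_cases i <;> simp [basisN3, Fin.sum_univ_succ] <;> linarith

theorem span_cobasisN3 (d : ℤ) : Submodule.span ℤ (Set.range (cobasisN3 d)) = N3 d := by
  refine le_antisymm (Submodule.span_le.2 ?_) fun v hv => ?_
  · rintro _ ⟨i, rfl⟩
    rw [SetLike.mem_coe, mem_N3]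
    fin_cases i <;> simp [cobasisN3]
  · obtain ⟨h1, h2, h3, h4⟩ := mem_N3.1 hv
    refine (Submodule.mem_span_range_iff_exists_fun ℤ).2 ⟨![-v 0,
      -52 * v 2 + 8 * v 4 + 48 * v 5 - 23 * v 7,
      -25 * v 2 + 4 * v 4 + 24 * v 5 - 12 * v 7,
      -6 * v 2 + v 4 + 6 * v 5 - 3 * v 7,
      -8 * v 2 + 8 * v 4 - 6 * v 5 - 4 * v 7 + v 9,
      -14 * v 2 + 2 * v 4 + 13 * v 5 - 6 * v 7], ?_⟩
    funext i
    fin_cases i <;> simp [cobasisN3, Fin.sum_univ_succ] <;> linarith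

theorem bU2E82_basisN3_cobasisN3 (d : ℤ) (i j : Fin 6) :
    bU2E82 (basisN3 d i) (cobasisN3 d j) = if i = j then ![4 * d, 4, 4, 4, 2, 2] i else 0 := by
  rw [bU2E82_apply]
  fin_cases i <;> fin_cases j <;> simp [basisN3, cobasisN3]
  ring

/-- The discriminant group of `N_{3,d}` is isomorphic as an abelian group to
`ℤ/4d ⊕ (ℤ/4)^3 ⊕ (ℤ/2)^2`. -/
theorem discGroup_N3 (d : ℕ) (hd : 0 < d) :
    Nonempty (discGroup (N3 (d : ℤ)) ≃+
      (ZMod (4 * d) × (Fin 3 → ZMod 4) × (Fin 2 → ZMod 2))) := by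
  refine nonempty_discGroup_addEquiv (basisN3 d) (cobasisN3 d) ![4 * (d : ℤ), 4, 4, 4, 2, 2] ?_
    (span_basisN3 d) (span_cobasisN3 d) (bU2E82_basisN3_cobasisN3 d)
    { toFun := fun t => (t 0, fun i => t (![1, 2, 3] i), fun i => t (![4, 5] i))
      map_zero' := by ext <;> simp
      map_add' := fun s t => by ext <;> simp } ?_ ?_
  · intro i
    fin_cases i <;> simp [hd.ne']
  · rintro ⟨a, b, c⟩
    obtain ⟨a, rfl⟩ := ZMod.intCast_surjective a
    choose b' hb using fun i => ZMod.intCast_surjective (b i)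
    choose c' hc using fun i => ZMod.intCast_surjective (c i)
    refine ⟨![a, b' 0, b' 1, b' 2, c' 0, c' 1], ?_⟩
    refine Prod.ext rfl (Prod.ext (funext fun i => ?_) (funext fun i => ?_))
    · fin_cases i <;> exact hb _
    · fin_cases i <;> exact hc _
  · intro t
    have h4d : ((t 0 : ℤ) : ZMod (4 * d)) = 0 ↔ 4 * (d : ℤ) ∣ t 0 := by
      rw [ZMod.intCast_zmod_eq_zero_iff_dvd]
      push_cast
      rfl
    have h4 (a : ℤ) : (a : ZMod 4) = 0 ↔ 4 ∣ a := ZMod.intCast_zmod_eq_zero_iff_dvd a 4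
    have h2 (a : ℤ) : (a : ZMod 2) = 0 ↔ 2 ∣ a := ZMod.intCast_zmod_eq_zero_iff_dvd a 2
    simp [Prod.ext_iff, funext_iff, Fin.forall_fin_succ, h4d, h4, h2]
    tauto
end
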